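/- Let 0 ≤ γ ≤ 1 and let X be an n×d real matrix. Then ‖(I − P − γ(I − W)) * X‖_F ≤ (1 − γ(1 − σ)) · ‖(I − P) * X‖_F, where I is the n×n identity matrix. -/

import Mathlib

/-- Frobenius norm of an `n × d` real matrix. -/
noncomputable def frob {n d : ℕ} (X : Matrix (Fin n) (Fin d) ℝ) : ℝ :=
  Real.sqrt (∑ i, ∑ j, (X i j) ^ 2)

section Frobenius

attribute [local instance] Matrix.frobeniusNormedAddCommGroup Matrix.frobeniusNormedSpace

lemma frob_eq_norm {n d : ℕ} (X : Matrix (Fin n) (Fin d) ℝ) : frob X = ‖X‖ := by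
  simp [frob, Matrix.frobenius_norm_def, Real.sqrt_eq_rpow]

lemma frob_add_le {n d : ℕ} (X Y : Matrix (Fin n) (Fin d) ℝ) :
    frob (X + Y) ≤ frob X + frob Y := by
  simpa only [frob_eq_norm] using norm_add_le X Y

lemma frob_smul {n d : ℕ} (c : ℝ) (X : Matrix (Fin n) (Fin d) ℝ) :
    frob (c • X) = |c| * frob X := by
  simpa only [frob_eq_norm, Real.norm_eq_abs] using norm_smul c X

end Frobenius

/-- A Euclidean operator bound for `A` gives a Frobenius bound for left multiplication by `A`. -/
lemma frob_mul_le {m n d : ℕ} {A : Matrix (Fin m) (Fin n) ℝ} {σ : ℝ} (hσ : 0 ≤ σ)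
    (hA : ∀ v : Fin n → ℝ,
      Real.sqrt (∑ i, (A.mulVec v i) ^ 2) ≤ σ * Real.sqrt (∑ i, (v i) ^ 2))
    (Y : Matrix (Fin n) (Fin d) ℝ) : frob (A * Y) ≤ σ * frob Y := by
  have hcol (j : Fin d) : ∑ i, ((A * Y) i j) ^ 2 ≤ σ ^ 2 * ∑ i, (Y i j) ^ 2 := by
    have h := hA fun i => Y i j
    rw [Real.sqrt_le_left (by positivity), mul_pow, Real.sq_sqrt (by positivity)] at h
    exact h
  unfold frob
  rw [Real.sqrt_le_left (by positivity), mul_pow, Real.sq_sqrt (by positivity),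
    Finset.sum_comm, Finset.sum_comm (f := fun i j => Y i j ^ 2), Finset.mul_sum]
  exact Finset.sum_le_sum fun j _ => hcol j

/-- A matrix with unit row sums fixes the averaging matrix. -/
lemma mul_averaging_eq {n : ℕ} {W P : Matrix (Fin n) (Fin n) ℝ}
    (hWrow : ∀ i, ∑ j, W i j = 1) (hP : ∀ i j, P i j = 1 / (n : ℝ)) : W * P = P := by
  ext i j
  simp only [Matrix.mul_apply, hP, ← Finset.sum_mul, hWrow, one_mul]

/-- Inequality (eq-35) in the proof of Lemma 8: for `0 ≤ γ ≤ 1`,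
`‖(I - P - γ(I - W)) X‖_F ≤ (1 - γ(1 - σ)) ‖(I - P) X‖_F`. -/
theorem stmt_11 (n d : ℕ) (hn : 1 ≤ n) (γ σ : ℝ)
    (hγ0 : 0 ≤ γ) (hγ1 : γ ≤ 1) (hσ : 0 ≤ σ)
    (W P : Matrix (Fin n) (Fin n) ℝ)
    (hWnn : ∀ i j, 0 ≤ W i j) (hWsymm : W.IsSymm) (hWrow : ∀ i, ∑ j, W i j = 1)
    (hP : ∀ i j, P i j = 1 / (n : ℝ))
    (hσW : ∀ v : Fin n → ℝ,
      Real.sqrt (∑ i, ((W - P).mulVec v i) ^ 2) ≤ σ * Real.sqrt (∑ i, (v i) ^ 2))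
    (X : Matrix (Fin n) (Fin d) ℝ) :
    frob ((1 - P - γ • (1 - W)) * X) ≤ (1 - γ * (1 - σ)) * frob ((1 - P) * X) := by
  have hn' : (n : ℝ) ≠ 0 := by positivity
  have hWP : W * P = P := mul_averaging_eq hWrow hP
  have hPP : P * P = P := mul_averaging_eq (fun i => by simp [hP, hn']) hP
  have hproj : (W - P) * (1 - P) = W - P := by
    rw [mul_sub, mul_one, sub_mul, hWP, hPP, sub_self, sub_zero]
  have hsplit : (1 - P - γ • (1 - W)) * X =
      (1 - γ) • ((1 - P) * X) + γ • ((W - P) * ((1 - P) * X)) := by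
    rw [← Matrix.mul_assoc, hproj, ← Matrix.smul_mul, ← Matrix.smul_mul, ← Matrix.add_mul]
    congr 1
    module
  rw [hsplit]
  calc
    _ ≤ (1 - γ) * frob ((1 - P) * X) + γ * frob ((W - P) * ((1 - P) * X)) := by
      refine (frob_add_le _ _).trans_eq ?_
      rw [frob_smul, frob_smul, abs_of_nonneg (sub_nonneg.2 hγ1), abs_of_nonneg hγ0]
    _ ≤ (1 - γ) * frob ((1 - P) * X) + γ * (σ * frob ((1 - P) * X)) := by
      gcongr
      exact frob_mul_le hσ hσW _
    _ = _ := by ring
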